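/- arXiv:1304.7336 — 2 statements merged into one kernel-verified Lean document; each statement's English description precedes it below -/
import Mathlib

section
/- Let A be a finite-dimensional n-Lie algebra. Then A is nilpotent if and only if every maximal subalgebra M of A is a weak ideal of A, i.e., [A,M,...,M] ⊆ M. -/
/-- An `n`-Lie algebra over a field `F`: a vector space with an `n`-linear alternating
bracket satisfying the Filippov–Jacobi identity (every left multiplication operator is a
derivation of the bracket). -/
structure NLie (F : Type*) (A : Type*) [Field F] [AddCommGroup A] [Module F A] (n : ℕ) where
  bracket : A [⋀^Fin n]→ₗ[F] A
  jacobi : ∀ (a : Fin n → A) (i : Fin n) (b : Fin n → A),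
    bracket (Function.update a i (bracket b)) =
      ∑ j : Fin n, bracket (Function.update b j (bracket (Function.update a i (b j))))

namespace NLie

variable {F A : Type*} [Field F] [AddCommGroup A] [Module F A] {n : ℕ}

/-- A subalgebra: a subspace closed under the bracket. -/
def IsSubalgebra (L : NLie F A n) (S : Submodule F A) : Prop :=
  ∀ x : Fin n → A, (∀ i, x i ∈ S) → L.bracket x ∈ S

/-- A weak ideal: a subspace `I` with `[A,I,…,I] ⊆ I`. -/
def IsWeakIdeal (L : NLie F A n) (I : Submodule F A) : Prop :=
  ∀ x : Fin n → A, (∃ i, ∀ j, j ≠ i → x j ∈ I) → L.bracket x ∈ I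

/-- `[A,…,A,M]`: the span of all brackets with at least one entry in `M`. -/
def amul (L : NLie F A n) (M : Submodule F A) : Submodule F A :=
  Submodule.span F {z | ∃ x : Fin n → A, (∃ i, x i ∈ M) ∧ z = L.bracket x}

/-- The lower central series: `lcs 0 = A¹ = A`, `lcs s = A^{s+1} = [A,…,A,A^s]`. -/
def lcs (L : NLie F A n) : ℕ → Submodule F A
  | 0 => ⊤
  | s + 1 => L.amul (L.lcs s)

/-- `A` is nilpotent if the lower central series reaches `0`. -/
def IsNilpotentAlg (L : NLie F A n) : Prop := ∃ v, L.lcs v = ⊥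

/-- The derived subalgebra `A² = [A,…,A]`. -/
def derived (L : NLie F A n) : Submodule F A := L.lcs 1

/-- Maximal subalgebras: proper subalgebras maximal among proper subalgebras. -/
def IsMaximalSubalgebra (L : NLie F A n) (S : Submodule F A) : Prop :=
  L.IsSubalgebra S ∧ S ≠ ⊤ ∧ ∀ T, L.IsSubalgebra T → S < T → T = ⊤

end NLie

namespace NLie

variable {F A : Type*} [Field F] [AddCommGroup A] [Module F A] {n : ℕ}

/-- The left multiplication operator `z ↦ [a₁,…,z,…,aₙ]`, with `z` in position `i`. -/
def leftMul (L : NLie F A n) (a : Fin n → A) (i : Fin n) : Module.End F A :=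
  L.bracket.toMultilinearMap.toLinearMap a i

@[simp]
theorem leftMul_apply (L : NLie F A n) (a : Fin n → A) (i : Fin n) (z : A) :
    L.leftMul a i z = L.bracket (Function.update a i z) := rfl

/-- The subspace of those `z` with `[B,…,B,z] ⊆ U`. -/
def colon (L : NLie F A n) (B U : Submodule F A) : Submodule F A where
  carrier := {z | ∀ (v : Fin n → A) (i : Fin n), (∀ j, j ≠ i → v j ∈ B) →
    L.bracket (Function.update v i z) ∈ U}
  zero_mem' v i _ := by
    rw [L.bracket.map_update_zero]
    exact U.zero_mem
  add_mem' hy hz v i hv := by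
    rw [L.bracket.map_update_add]
    exact U.add_mem (hy v i hv) (hz v i hv)
  smul_mem' c z hz v i hv := by
    rw [L.bracket.map_update_smul]
    exact U.smul_mem c (hz v i hv)

theorem mem_colon {L : NLie F A n} {B U : Submodule F A} {z : A} :
    z ∈ L.colon B U ↔ ∀ (v : Fin n → A) (i : Fin n), (∀ j, j ≠ i → v j ∈ B) →
      L.bracket (Function.update v i z) ∈ U := Iff.rfl

theorem colon_anti {L : NLie F A n} {B C U : Submodule F A} (h : C ≤ B) :
    L.colon B U ≤ L.colon C U :=
  fun _ hz v i hv => hz v i fun j hj => h (hv j hj)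

theorem IsSubalgebra.le_colon {L : NLie F A n} {B C : Submodule F A} (hB : L.IsSubalgebra B)
    (h : C ≤ B) : B ≤ L.colon C B := by
  intro z hz v i hv
  refine hB _ fun j => ?_
  rcases eq_or_ne j i with rfl | hj
  · simpa using hz
  · simpa [hj] using h (hv j hj)

/-- `B` acts nilpotently on `A`: every proper inclusion `U < V` of `B`-invariant subspaces admits
a nonzero vector of `V / U` killed by all left multiplications by elements of `B`. -/
def ActsNilpotently (L : NLie F A n) (B : Submodule F A) : Prop :=
  ∀ U V : Submodule F A, U < V → U ≤ L.colon B U → V ≤ L.colon B V →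
    ∃ x ∈ V, x ∉ U ∧ x ∈ L.colon B U

/-- The `n`-Lie algebra obtained from an `(n+1)`-Lie algebra by fixing one entry of the bracket. -/
def contract (L : NLie F A (n + 1)) (x : A) : NLie F A n where
  bracket := L.bracket.curryLeft x
  jacobi a i b := by
    have h := L.jacobi (Matrix.vecCons x a) i.succ (Matrix.vecCons x b)
    have h0 : L.bracket (Function.update (Matrix.vecCons x b) 0
        (L.bracket (Function.update (Matrix.vecCons x a) i.succ x))) = 0 := by
      rw [L.bracket.map_eq_zero_of_eq (Function.update (Matrix.vecCons x a) i.succ x)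
        (i := 0) (j := i.succ) (by simp [(Fin.succ_ne_zero i).symm]) (Fin.succ_ne_zero i).symm]
      exact L.bracket.map_update_zero _ _
    rw [Fin.sum_univ_succ] at h
    simp only [Matrix.cons_val_zero, Matrix.cons_val_succ, h0, zero_add] at h
    simpa [Matrix.vecCons, ← Fin.cons_update] using h

theorem contract_bracket (L : NLie F A (n + 1)) (x : A) (v : Fin n → A) :
    (L.contract x).bracket v = L.bracket (Matrix.vecCons x v) := rfl

theorem contract_bracket_update (L : NLie F A (n + 1)) (x : A) (v : Fin n → A) (i : Fin n)
    (z : A) : (L.contract x).bracket (Function.update v i z) =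
      L.bracket (Function.update (Matrix.vecCons x v) i.succ z) := by
  rw [contract_bracket]
  simp [Matrix.vecCons, ← Fin.cons_update]

theorem contract_leftMul (L : NLie F A (n + 1)) (x : A) (a : Fin n → A) (i : Fin n) :
    (L.contract x).leftMul a i = L.leftMul (Matrix.vecCons x a) i.succ :=
  LinearMap.ext fun z => L.contract_bracket_update x a i z

/-- Left multiplications are derivations of the bracket, rewritten as a commutator formula. -/
theorem leftMul_leftMul (L : NLie F A n) (a b : Fin n → A) (i k : Fin n) (z : A) :
    L.leftMul a i (L.leftMul b k z) = L.leftMul b k (L.leftMul a i z) +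
      ∑ j ∈ Finset.univ.erase k,
        L.leftMul (Function.update b j (L.leftMul a i (b j))) k z := by
  simp only [leftMul_apply]
  rw [L.jacobi, ← Finset.add_sum_erase _ _ (Finset.mem_univ k)]
  congr 1
  · simp
  · refine Finset.sum_congr rfl fun j hj => ?_
    have hjk := Finset.ne_of_mem_erase hj
    rw [Function.update_of_ne hjk, Function.update_comm hjk]

/-- If `[C,…,C,z] ⊆ U` and all brackets of `z` with `x` and elements of `C + Fx` lie in `U`, then
`[C + Fx,…,C + Fx,z] ⊆ U`. -/
theorem mem_colon_sup_span {L : NLie F A n} {C U : Submodule F A} {x z : A}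
    (hC : z ∈ L.colon C U)
    (hx : ∀ (v : Fin n → A) (i k : Fin n), k ≠ i → v k = x →
      (∀ j, j ≠ i → v j ∈ C ⊔ F ∙ x) → L.bracket (Function.update v i z) ∈ U) :
    z ∈ L.colon (C ⊔ F ∙ x) U := by
  intro v i hv
  suffices H : ∀ (s : Finset (Fin n)) (v : Fin n → A), (∀ j, j ≠ i → v j ∈ C ⊔ F ∙ x) →
      (∀ j, j ≠ i → j ∉ s → v j ∈ C) → L.bracket (Function.update v i z) ∈ U from
    H Finset.univ v hv fun j _ hj => absurd (Finset.mem_univ j) hj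
  intro s
  induction s using Finset.induction_on with
  | empty => exact fun v _ hv => hC v i fun j hj => hv j hj (Finset.notMem_empty j)
  | insert k s _ ih =>
    intro v hv hs
    by_cases hk : k = i
    · exact ih v hv fun j hj hjs => hs j hj (by simp [hjs, hk, hj])
    obtain ⟨c, hc, y, hy, hcy⟩ := Submodule.mem_sup.1 (hv k hk)
    obtain ⟨t, rfl⟩ := Submodule.mem_span_singleton.1 hy
    have hup : ∀ w : A, Function.update (Function.update v i z) k w =
        Function.update (Function.update v k w) i z := fun w =>
      (Function.update_comm hk _ _ _).symm
    have hmem : ∀ w ∈ C ⊔ F ∙ x, ∀ j, j ≠ i → Function.update v k w j ∈ C ⊔ F ∙ x := by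
      intro w hw j hj
      rcases eq_or_ne j k with rfl | hjk
      · simpa using hw
      · simpa [hjk] using hv j hj
    have hsplit : Function.update v i z =
        Function.update (Function.update v i z) k (c + t • x) := by
      rw [hcy, hup, Function.update_eq_self]
    rw [hsplit, L.bracket.map_update_add, L.bracket.map_update_smul, hup, hup]
    refine U.add_mem (ih _ (hmem c (Submodule.mem_sup_left hc)) fun j hj hjs => ?_)
      (U.smul_mem t (hx _ i k hk (by simp) (hmem x
        (Submodule.mem_sup_right (Submodule.mem_span_singleton_self x)))))
    rcases eq_or_ne j k with rfl | hjk
    · simpa using hc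
    · simpa [hjk] using hs j hj (by simp [hjk, hjs])

theorem bracket_update_mem_of_mem_colon_contract {L : NLie F A (n + 1)} {B U : Submodule F A}
    {x z : A} (hz : z ∈ (L.contract x).colon B U) {v : Fin (n + 1) → A} {i k : Fin (n + 1)}
    (hk : k ≠ i) (hvk : v k = x) (hv : ∀ j, j ≠ i → j ≠ k → v j ∈ B) :
    L.bracket (Function.update v i z) ∈ U := by
  set σ := Equiv.swap 0 k with hσ
  have hσi : σ i ≠ 0 := by
    intro h
    apply hk
    rw [← Equiv.swap_apply_left 0 k, ← hσ, ← h]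
    simp [hσ]
  obtain ⟨i', hi'⟩ := Fin.exists_succ_eq.2 hσi
  have hσσ : ∀ j, σ (σ j) = j := Equiv.swap_apply_self 0 k
  have hcomp : Function.update v i z ∘ σ =
      Function.update (Matrix.vecCons x fun j => v (σ j.succ)) i'.succ z := by
    funext j
    rw [hi']
    rcases eq_or_ne j (σ i) with rfl | hj
    · simp [hσσ]
    · have : σ j ≠ i := fun h => hj (by rw [← h, hσσ])
      rw [Function.comp_apply, Function.update_of_ne this, Function.update_of_ne hj]
      refine Fin.cases ?_ (fun j => ?_) j
      · simp [hσ, hvk]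
      · simp
  have h := hz (fun j => v (σ j.succ)) i' fun j hj => by
    refine hv _ (fun h => hj ?_) fun h => ?_
    · apply Fin.succ_injective
      rw [hi', ← h, hσσ]
    · have := congrArg σ h
      rw [hσσ] at this
      simp [hσ] at this
  rw [contract_bracket_update, ← hcomp, L.bracket.map_perm] at h
  rcases Int.units_eq_one_or (Equiv.Perm.sign σ) with hs | hs <;> simpa [hs] using h

theorem mem_colon_sup_span_of_contract {L : NLie F A (n + 1)} {C U : Submodule F A} {x z : A}
    (hC : z ∈ L.colon C U) (hx : z ∈ (L.contract x).colon C U) :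
    z ∈ L.colon (C ⊔ F ∙ x) U := by
  refine mem_colon_sup_span hC fun v i k hk hvk hv =>
    bracket_update_mem_of_mem_colon_contract (mem_colon_sup_span hx ?_) hk hvk
      fun j hj _ => hv j hj
  intro v i k hk hvk _
  rw [contract_bracket, L.bracket.map_eq_zero_of_eq _ (i := 0) (j := k.succ) _
    (Fin.succ_ne_zero k).symm]
  · exact U.zero_mem
  · simp [hk, hvk]

theorem bracket_vecCons_mem {L : NLie F A (n + 1)} {C U : Submodule F A} {x : A}
    (hx : x ∈ L.colon C U) {v : Fin n → A} (hv : ∀ j, v j ∈ C) :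
    L.bracket (Matrix.vecCons x v) ∈ U := by
  have h := hx (Matrix.vecCons x v) 0 fun j hj => by
    obtain ⟨j, rfl⟩ := Fin.exists_succ_eq.2 hj
    simpa using hv j
  rwa [Function.update_eq_self_iff.2 (by simp)] at h

theorem actsNilpotently_bot {L : NLie F A (n + 1)} (hL : IsNilpotent (L.leftMul 0 0)) :
    L.ActsNilpotently ⊥ := by
  classical
  intro U V hUV hU hV
  obtain ⟨y, hyV, hyU⟩ := SetLike.exists_of_lt hUV
  have hbot : ∀ j : Fin (n + 1), j ≠ 0 → (0 : Fin (n + 1) → A) j ∈ (⊥ : Submodule F A) :=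
    fun _ _ => Submodule.zero_mem _
  have hex : ∃ k, (L.leftMul 0 0 ^ k) y ∈ U := by
    obtain ⟨k, hk⟩ := hL
    exact ⟨k, by simp [hk]⟩
  have hVk : ∀ k, (L.leftMul 0 0 ^ k) y ∈ V := by
    intro k
    induction k with
    | zero => simpa using hyV
    | succ k ih =>
      rw [pow_succ', Module.End.mul_apply]
      exact hV ih 0 0 hbot
  obtain ⟨k, hk⟩ : ∃ k, Nat.find hex = k + 1 :=
    Nat.exists_eq_succ_of_ne_zero fun h => hyU (by simpa [h] using Nat.find_spec hex)
  refine ⟨(L.leftMul 0 0 ^ k) y, hVk k, Nat.find_min hex (by omega), fun v i hv => ?_⟩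
  rcases eq_or_ne i 0 with rfl | hi
  · have h := Nat.find_spec hex
    rw [hk, pow_succ', Module.End.mul_apply, leftMul_apply] at h
    convert h using 2
    funext j
    rcases eq_or_ne j 0 with rfl | hj
    · simp
    · simpa [hj] using hv j hj
  · rw [L.bracket.map_coord_zero 0]
    · exact U.zero_mem
    · simpa [hi.symm] using hv 0 hi.symm

/-- The inductive step of Engel's theorem: adjoining to a subalgebra `C` an element `x` which
normalizes it. -/
theorem ActsNilpotently.sup_span {L : NLie F A (n + 1)} {C : Submodule F A} {x : A}
    (hx : x ∈ L.colon C C) (hLC : L.ActsNilpotently C) (hxC : (L.contract x).ActsNilpotently C) :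
    L.ActsNilpotently (C ⊔ F ∙ x) := by
  intro U V hUV hU hV
  have hCB : C ≤ C ⊔ F ∙ x := le_sup_left
  have hxB : x ∈ C ⊔ F ∙ x := Submodule.mem_sup_right (Submodule.mem_span_singleton_self x)
  have hcons : ∀ (c : Fin n → A) (i : Fin n), (∀ j, j ≠ i → c j ∈ C) →
      ∀ j, j ≠ i.succ → Matrix.vecCons x c j ∈ C ⊔ F ∙ x := by
    intro c i hc j
    refine Fin.cases (fun _ => by simpa using hxB) (fun j hj => ?_) j
    simpa using hCB (hc j fun h => hj (by rw [h]))
  have hcolon : ∀ S : Submodule F A, L.colon (C ⊔ F ∙ x) S ≤ (L.contract x).colon C S := by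
    intro S z hz c i hc
    rw [contract_bracket_update]
    exact hz _ _ (hcons c i hc)
  have hUW : U < V ⊓ L.colon C U := by
    obtain ⟨y, hyV, hyU, hy⟩ := hLC U V hUV (hU.trans (colon_anti hCB)) (hV.trans (colon_anti hCB))
    exact SetLike.lt_iff_le_and_exists.2
      ⟨le_inf hUV.le (hU.trans (colon_anti hCB)), y, Submodule.mem_inf.2 ⟨hyV, hy⟩, hyU⟩
  obtain ⟨y, hyW, hyU, hy⟩ := hxC U (V ⊓ L.colon C U) hUW (hU.trans (hcolon U)) (by
    intro z hz c i hc
    refine ⟨hcolon V (hV hz.1) c i hc, fun d k hd => ?_⟩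
    rw [contract_bracket_update]
    have hcomm := L.leftMul_leftMul (Matrix.vecCons x c) d i.succ k z
    rw [← leftMul_apply, ← leftMul_apply, eq_sub_iff_add_eq.2 hcomm.symm]
    refine U.sub_mem (hU (hz.2 d k hd) _ _ (hcons c i hc)) (U.sum_mem fun j hj => ?_)
    refine hz.2 _ k fun l hl => ?_
    rcases eq_or_ne l j with rfl | hlj
    · rw [Function.update_self, ← contract_leftMul]
      refine bracket_vecCons_mem hx fun m => ?_
      rcases eq_or_ne m i with rfl | hm
      · simpa using hd l hl
      · simpa [hm] using hc m hm
    · simpa [hlj] using hd l hl)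
  exact ⟨y, hyW.1, hyU, mem_colon_sup_span_of_contract hyW.2 hy⟩

theorem sup_span_isSubalgebra {L : NLie F A (n + 1)} {C : Submodule F A} {x : A}
    (hC : L.IsSubalgebra C) (hx : x ∈ L.colon C C) : L.IsSubalgebra (C ⊔ F ∙ x) := by
  have hle : C ⊔ F ∙ x ≤ L.colon (C ⊔ F ∙ x) C := by
    refine sup_le (fun z hz => ?_) ((Submodule.span_singleton_le_iff_mem _ _).2 ?_)
    · refine mem_colon_sup_span_of_contract (hC.le_colon le_rfl hz) fun c i hc => ?_
      refine bracket_vecCons_mem hx fun m => ?_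
      rcases eq_or_ne m i with rfl | hm
      · simpa using hz
      · simpa [hm] using hc m hm
    · refine mem_colon_sup_span_of_contract hx fun c i _ => ?_
      rw [contract_bracket, L.bracket.map_eq_zero_of_eq _ (i := 0) (j := i.succ) _
        (Fin.succ_ne_zero i).symm]
      · exact C.zero_mem
      · simp
  intro v hv
  have h := hle (hv 0) v 0 fun j _ => hv j
  rw [Function.update_eq_self] at h
  exact le_sup_left (a := C) h

/-- **Engel's theorem** for `n`-Lie algebras: if all left multiplications are nilpotent, then every
subalgebra acts nilpotently. -/
theorem IsSubalgebra.actsNilpotently [FiniteDimensional F A] {L : NLie F A n}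
    (hL : ∀ a i, IsNilpotent (L.leftMul a i)) {B : Submodule F A} (hB : L.IsSubalgebra B) :
    L.ActsNilpotently B := by
  induction n generalizing B with
  | zero =>
    intro U V hUV _ _
    obtain ⟨y, hyV, hyU⟩ := SetLike.exists_of_lt hUV
    exact ⟨y, hyV, hyU, fun _ i => i.elim0⟩
  | succ n ih =>
    induction B using WellFoundedLT.induction with
    | ind B ihB =>
    rcases eq_or_ne B ⊥ with rfl | hne
    · exact actsNilpotently_bot (hL 0 0)
    obtain ⟨C, hC⟩ := exists_maximal_of_wellFoundedGT
      (fun C : Submodule F A => L.IsSubalgebra C ∧ C < B)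
      ⟨⊥, fun v hv => by
        rw [L.bracket.map_coord_zero 0 ((Submodule.mem_bot F).1 (hv 0))]
        exact Submodule.zero_mem _, bot_lt_iff_ne_bot.2 hne⟩
    obtain ⟨⟨hCs, hCB⟩, hmax⟩ := hC
    obtain ⟨x, hxB, hxC, hx⟩ := ihB C hCB hCs C B hCB (hCs.le_colon le_rfl)
      (hB.le_colon hCB.le)
    have hle : C ⊔ F ∙ x ≤ B :=
      sup_le hCB.le ((Submodule.span_singleton_le_iff_mem _ _).2 hxB)
    have hxm : x ∈ C ⊔ F ∙ x := Submodule.mem_sup_right (Submodule.mem_span_singleton_self x)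
    have heq : C ⊔ F ∙ x = B := by
      by_contra h
      exact hxC (hmax ⟨sup_span_isSubalgebra hCs hx, lt_of_le_of_ne hle h⟩ le_sup_left hxm)
    rw [← heq]
    refine ActsNilpotently.sup_span hx (ihB C hCB hCs) (ih (fun a i => ?_) fun v hv => ?_)
    · rw [contract_leftMul]
      exact hL _ _
    · exact bracket_vecCons_mem hx hv

theorem amul_le_iff {L : NLie F A n} {M N : Submodule F A} :
    L.amul M ≤ N ↔ M ≤ L.colon ⊤ N := by
  rw [amul, Submodule.span_le]
  constructor
  · exact fun h z hz v i _ => h ⟨_, ⟨i, by simpa using hz⟩, rfl⟩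
  · rintro h _ ⟨v, ⟨i, hi⟩, rfl⟩
    have := h hi v i fun _ _ => Submodule.mem_top
    rwa [Function.update_eq_self] at this

theorem amul_mono (L : NLie F A n) : Monotone L.amul := fun _ _ h =>
  amul_le_iff.2 (h.trans (amul_le_iff.1 le_rfl))

theorem lcs_eq_iterate (L : NLie F A n) (k : ℕ) : L.lcs k = L.amul^[k] ⊤ := by
  induction k with
  | zero => rfl
  | succ k ih => rw [Function.iterate_succ_apply', ← ih, lcs]

theorem ActsNilpotently.isNilpotentAlg [FiniteDimensional F A] {L : NLie F A n}
    (h : L.ActsNilpotently ⊤) : L.IsNilpotentAlg := by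
  obtain ⟨U, ⟨hU, k, hk⟩, hmax⟩ := exists_maximal_of_wellFoundedGT
    (fun U : Submodule F A => U ≤ L.colon ⊤ U ∧ ∃ k, L.amul^[k] U = ⊥)
    ⟨⊥, bot_le, 0, rfl⟩
  rcases eq_or_ne U ⊤ with rfl | hne
  · exact ⟨k, by rw [lcs_eq_iterate, hk]⟩
  obtain ⟨x, -, hxU, hx⟩ := h U ⊤ (lt_top_iff_ne_top.2 hne) hU
    (IsSubalgebra.le_colon (fun _ _ => Submodule.mem_top) le_rfl)
  have hle : U ⊔ F ∙ x ≤ L.colon ⊤ U :=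
    sup_le hU ((Submodule.span_singleton_le_iff_mem _ _).2 hx)
  refine absurd (hmax ⟨?_, k + 1, ?_⟩ le_sup_left
    (Submodule.mem_sup_right (Submodule.mem_span_singleton_self x))) hxU
  · exact amul_le_iff.1 ((amul_le_iff.2 hle).trans le_sup_left)
  · rw [Function.iterate_succ_apply, eq_bot_iff, ← hk]
    exact L.amul_mono.iterate k (amul_le_iff.2 hle)

/-- The Fitting null component of a left multiplication is a subalgebra. -/
theorem isSubalgebra_ker_leftMul_pow [FiniteDimensional F A] (L : NLie F A n) (a : Fin n → A)
    (i : Fin n) :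
    L.IsSubalgebra (LinearMap.ker (L.leftMul a i ^ Module.finrank F A)) := by
  set T := L.leftMul a i with hT
  set d := Module.finrank F A
  have hback : ∀ z, T z ∈ LinearMap.ker (T ^ d) → z ∈ LinearMap.ker (T ^ d) := by
    intro z hz
    apply Module.End.ker_pow_le_ker_pow_finrank T (d + 1)
    rwa [LinearMap.mem_ker, pow_succ, Module.End.mul_apply]
  suffices H : ∀ (m : ℕ) (k : Fin n → ℕ) (b : Fin n → A), ∑ j, k j = m →
      (∀ j, (T ^ k j) (b j) = 0) → L.bracket b ∈ LinearMap.ker (T ^ d) from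
    fun b hb => H _ (fun _ => d) b rfl hb
  intro m
  induction m using Nat.strong_induction_on with
  | _ m ih =>
    intro k b hkm hb
    by_cases h0 : ∃ j, k j = 0
    · obtain ⟨j, hj⟩ := h0
      rw [L.bracket.map_coord_zero j (by simpa [hj] using hb j)]
      exact Submodule.zero_mem _
    push Not at h0
    apply hback
    rw [hT, leftMul_apply, L.jacobi]
    refine Submodule.sum_mem _ fun j _ => ?_
    have hlt : ∑ l, Function.update k j (k j - 1) l < ∑ l, k l := by
      refine Finset.sum_lt_sum (fun l _ => ?_) ⟨j, Finset.mem_univ j, ?_⟩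
      · rcases eq_or_ne l j with rfl | hl
        · simp
        · simp [hl]
      · have := h0 j
        simp only [Function.update_self]
        omega
    refine ih _ (hkm ▸ hlt) (Function.update k j (k j - 1)) _ rfl fun l => ?_
    rcases eq_or_ne l j with rfl | hl
    · simp only [Function.update_self]
      rw [← leftMul_apply, ← hT, ← Module.End.mul_apply, ← pow_succ,
        Nat.sub_add_cancel (Nat.pos_of_ne_zero (h0 l)), hb]
    · simpa [hl] using hb l

theorem isNilpotent_leftMul [FiniteDimensional F A] {L : NLie F A n}
    (h : ∀ M, L.IsMaximalSubalgebra M → L.IsWeakIdeal M) (a : Fin n → A) (i : Fin n) :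
    IsNilpotent (L.leftMul a i) := by
  set T := L.leftMul a i with hT
  set d := Module.finrank F A
  refine ⟨d, LinearMap.ker_eq_top.1 ?_⟩
  by_contra hne
  obtain ⟨M, ⟨hMs, hMd, hMne⟩, hmax⟩ := exists_maximal_of_wellFoundedGT
    (fun M : Submodule F A => L.IsSubalgebra M ∧ LinearMap.ker (T ^ d) ≤ M ∧ M ≠ ⊤)
    ⟨_, L.isSubalgebra_ker_leftMul_pow a i, le_rfl, hne⟩
  have hM : L.IsMaximalSubalgebra M := by
    refine ⟨hMs, hMne, fun S hS hlt => ?_⟩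
    by_contra hSt
    exact hlt.not_ge (hmax ⟨hS, hMd.trans hlt.le, hSt⟩ hlt.le)
  have ha : ∀ j, j ≠ i → a j ∈ M := by
    intro j hj
    apply hMd
    apply Module.End.ker_pow_le_ker_pow_finrank T 1
    rw [LinearMap.mem_ker, pow_one, hT, leftMul_apply]
    exact L.bracket.map_eq_zero_of_eq _ (by simp [hj]) hj
  have hrange : ∀ z, T z ∈ M := fun z =>
    h M hM _ ⟨i, fun j hj => by simpa [hj] using ha j hj⟩
  obtain ⟨N, hN⟩ := Filter.eventually_atTop.1 T.eventually_codisjoint_ker_pow_range_pow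
  apply hMne
  rw [eq_top_iff, ← (hN (N + 1) N.le_succ).eq_top]
  refine sup_le ((Module.End.ker_pow_le_ker_pow_finrank T _).trans hMd) ?_
  rintro _ ⟨z, rfl⟩
  rw [pow_succ', Module.End.mul_apply]
  exact hrange _

/-- In a nilpotent algebra every maximal subalgebra contains the derived algebra. -/
theorem IsMaximalSubalgebra.lcs_one_le {L : NLie F A n} {M : Submodule F A}
    (hL : L.IsNilpotentAlg) (hM : L.IsMaximalSubalgebra M) : L.lcs 1 ≤ M := by
  classical
  obtain ⟨v, hv⟩ := hL
  have hex : ∃ s, L.lcs s ≤ M := ⟨v, hv ▸ bot_le⟩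
  obtain ⟨s, hs⟩ : ∃ s, Nat.find hex = s + 1 :=
    Nat.exists_eq_succ_of_ne_zero fun h0 => hM.2.1 (by
      have := Nat.find_spec hex
      rwa [h0, lcs, top_le_iff] at this)
  have hsM : L.lcs s ≤ L.colon ⊤ M := amul_le_iff.1 (by simpa only [hs, lcs] using Nat.find_spec hex)
  have hnot : ¬ L.lcs s ≤ M := Nat.find_min hex (by omega)
  have hbr : ∀ v : Fin n → A, (∀ i, v i ∈ M ⊔ L.lcs s) → L.bracket v ∈ M := by
    suffices H : ∀ (t : Finset (Fin n)) (v : Fin n → A), (∀ i, v i ∈ M ⊔ L.lcs s) →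
        (∀ i, i ∉ t → v i ∈ M) → L.bracket v ∈ M from
      fun v hv => H Finset.univ v hv fun i hi => absurd (Finset.mem_univ i) hi
    intro t
    induction t using Finset.induction_on with
    | empty => exact fun v _ hv => hM.1 v fun i => hv i (Finset.notMem_empty i)
    | insert k t _ ih =>
      intro v hv ht
      obtain ⟨y, hy, z, hz, hyz⟩ := Submodule.mem_sup.1 (hv k)
      rw [← Function.update_eq_self k v, ← hyz, L.bracket.map_update_add]
      refine M.add_mem (ih _ (fun i => ?_) fun i hi => ?_)
        (hsM hz v k fun _ _ => Submodule.mem_top)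
      · rcases eq_or_ne i k with rfl | hik
        · simpa using Submodule.mem_sup_left hy
        · simpa [hik] using hv i
      · rcases eq_or_ne i k with rfl | hik
        · simpa using hy
        · simpa [hik] using ht i (by simp [hik, hi])
  have htop : M ⊔ L.lcs s = ⊤ :=
    hM.2.2 _ (fun v hv => Submodule.mem_sup_left (hbr v hv)) (left_lt_sup.2 hnot)
  refine amul_le_iff.2 fun z _ v i _ => hbr _ fun j => ?_
  rw [htop]
  exact Submodule.mem_top

end NLie

/-- A finite-dimensional `n`-Lie algebra is nilpotent if and only if every maximal
subalgebra is a weak ideal. -/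
theorem nilpotent_iff_maximal_subalgebras_weakIdeal {F A : Type*} [Field F] [AddCommGroup A]
    [Module F A] [FiniteDimensional F A] {n : ℕ} (hn : 2 ≤ n) (L : NLie F A n) :
    L.IsNilpotentAlg ↔ ∀ M, L.IsMaximalSubalgebra M → L.IsWeakIdeal M := by
  constructor
  · rintro hL M hM v ⟨i, -⟩
    exact hM.lcs_one_le hL (Submodule.subset_span ⟨v, ⟨i, Submodule.mem_top⟩, rfl⟩)
  · intro h
    have htop : L.IsSubalgebra ⊤ := fun _ _ => Submodule.mem_top
    exact (htop.actsNilpotently (NLie.isNilpotent_leftMul h)).isNilpotentAlg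
end

section
/- Let A be a finite-dimensional n-Lie algebra over a field. Then A is nilpotent if and only if A satisfies condition (*): the only subalgebra K of A with K + A^2 = A is K = A. -/
namespace NLie

variable {F A : Type*} [Field F] [AddCommGroup A] [Module F A] {n : ℕ}

theorem bracket_mem_amul (L : NLie F A n) {M : Submodule F A} {x : Fin n → A} {i : Fin n}
    (hi : x i ∈ M) : L.bracket x ∈ L.amul M :=
  Submodule.subset_span ⟨x, ⟨i, hi⟩, rfl⟩

/-- Changing every entry by an element of `M` changes a bracket by an element of
`[A,…,A,M]`. -/
theorem bracket_sub_bracket_mem_amul (L : NLie F A n) {M : Submodule F A} {x y : Fin n → A}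
    (hxy : ∀ i, x i - y i ∈ M) : L.bracket x - L.bracket y ∈ L.amul M := by
  suffices h : ∀ s : Finset (Fin n), L.bracket (s.piecewise x y) - L.bracket y ∈ L.amul M by
    simpa using h Finset.univ
  intro s
  induction s using Finset.induction_on with
  | empty => simp
  | insert i s hi ih =>
    have hy : s.piecewise x y = Function.update (s.piecewise x y) i (y i) := by
      rw [eq_comm, Function.update_eq_self_iff, Finset.piecewise_eq_of_notMem _ _ _ hi]
    have hmem : L.bracket (Function.update (s.piecewise x y) i (x i - y i)) ∈ L.amul M :=
      L.bracket_mem_amul (i := i) (by simpa using hxy i)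
    rw [L.bracket.map_update_sub, ← hy, ← Finset.piecewise_insert] at hmem
    simpa using add_mem hmem ih

/-- A subalgebra supplementing `A²` supplements every term of the lower central series. -/
theorem IsSubalgebra.sup_lcs_eq_top {L : NLie F A n} {K : Submodule F A}
    (hK : L.IsSubalgebra K) (h : K ⊔ L.derived = ⊤) (s : ℕ) : K ⊔ L.lcs s = ⊤ := by
  induction s with
  | zero => simp [lcs]
  | succ s ih =>
    rw [eq_top_iff, ← h]
    refine sup_le le_sup_left (Submodule.span_le.2 ?_)
    rintro _ ⟨x, -, rfl⟩
    have hx (i : Fin n) : ∃ y ∈ K, x i - y ∈ L.lcs s := by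
      obtain ⟨y, hy, z, hz, hyz⟩ :=
        Submodule.mem_sup.1 (ih ▸ Submodule.mem_top : x i ∈ K ⊔ L.lcs s)
      exact ⟨y, hy, by simpa [← hyz] using hz⟩
    choose y hyK hy using hx
    rw [← add_sub_cancel (L.bracket y) (L.bracket x)]
    exact Submodule.add_mem_sup (hK y hyK) (L.bracket_sub_bracket_mem_amul hy)

attribute [local instance] LieRing.ofAssociativeRing

/-- A derivation of an `n`-Lie algebra. -/
def IsDerivation (L : NLie F A n) (D : Module.End F A) : Prop :=
  ∀ b : Fin n → A, D (L.bracket b) = ∑ j, L.bracket (Function.update b j (D (b j)))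

theorem IsDerivation.apply_apply_bracket {L : NLie F A n} {D E : Module.End F A}
    (hD : L.IsDerivation D) (hE : L.IsDerivation E) (b : Fin n → A) :
    D (E (L.bracket b)) = ∑ j, (L.bracket (Function.update b j (D (E (b j)))) +
      ∑ k ∈ Finset.univ.erase j,
        L.bracket (Function.update (Function.update b j (E (b j))) k (D (b k)))) := by
  rw [hE, map_sum]
  refine Finset.sum_congr rfl fun j _ => ?_
  rw [hD, ← Finset.add_sum_erase _ _ (Finset.mem_univ j)]
  congr 1
  · simp
  · refine Finset.sum_congr rfl fun k hk => ?_
    rw [Function.update_of_ne (Finset.ne_of_mem_erase hk)]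

theorem IsDerivation.lie {L : NLie F A n} {D E : Module.End F A}
    (hD : L.IsDerivation D) (hE : L.IsDerivation E) : L.IsDerivation ⁅D, E⁆ := by
  intro b
  simp only [LieRing.of_associative_ring_bracket, LinearMap.sub_apply, Module.End.mul_apply,
    L.bracket.map_update_sub, Finset.sum_sub_distrib]
  rw [hD.apply_apply_bracket hE, hE.apply_apply_bracket hD, Finset.sum_add_distrib,
    Finset.sum_add_distrib]
  have hswap : ∑ j, ∑ k ∈ Finset.univ.erase j,
        L.bracket (Function.update (Function.update b j (E (b j))) k (D (b k))) =
      ∑ j, ∑ k ∈ Finset.univ.erase j,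
        L.bracket (Function.update (Function.update b j (D (b j))) k (E (b k))) := by
    rw [Finset.sum_comm' (t' := Finset.univ) (s' := fun k => Finset.univ.erase k)
      (by simp [eq_comm])]
    refine Finset.sum_congr rfl fun j _ => Finset.sum_congr rfl fun k hk => ?_
    rw [Function.update_comm (Finset.ne_of_mem_erase hk)]
  rw [hswap]
  abel

/-- The derivations with values in `A²`, as a Lie algebra of endomorphisms. -/
def derivedDerivations (L : NLie F A n) : LieSubalgebra F (Module.End F A) where
  carrier := {D | L.IsDerivation D ∧ ∀ x, D x ∈ L.derived}
  zero_mem' := ⟨fun b => by simp, fun x => by simp⟩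
  add_mem' hD hE := ⟨fun b => by
    simp [hD.1 b, hE.1 b, Finset.sum_add_distrib], fun x => add_mem (hD.2 x) (hE.2 x)⟩
  smul_mem' c D hD := ⟨fun b => by
    simp [hD.1 b, Finset.smul_sum], fun x => Submodule.smul_mem _ c (hD.2 x)⟩
  lie_mem' hD hE := ⟨hD.1.lie hE.1, fun x => sub_mem (hD.2 _) (hE.2 _)⟩

/-- The operator `y ↦ [a₁,…,y,…,aₙ]` with `y` in position `i`. -/
def mulOperator (L : NLie F A n) (a : Fin n → A) (i : Fin n) : L.derivedDerivations :=
  ⟨L.bracket.toMultilinearMap.toLinearMap a i, L.jacobi a i, fun _ =>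
    L.bracket_mem_amul (i := i) (M := L.lcs 0) Submodule.mem_top⟩

theorem mulOperator_lie (L : NLie F A n) (a : Fin n → A) (i : Fin n) :
    ⁅L.mulOperator a i, a i⁆ = L.bracket a :=
  congrArg L.bracket (Function.update_eq_self i a)

theorem IsDerivation.pow_bracket_eq_zero {L : NLie F A n} (hn : n ≠ 0) {D : Module.End F A}
    (hD : L.IsDerivation D) (N : ℕ) (b : Fin n → A) (m : Fin n → ℕ) (hm : ∑ i, m i ≤ N)
    (hb : ∀ i, (D ^ m i) (b i) = 0) : (D ^ N) (L.bracket b) = 0 := by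
  induction N generalizing b m with
  | zero =>
    have : b ⟨0, Nat.pos_of_ne_zero hn⟩ = 0 := by
      have h0 := Finset.sum_eq_zero_iff.1 (Nat.le_zero.1 hm) ⟨0, Nat.pos_of_ne_zero hn⟩
        (Finset.mem_univ _)
      simpa [h0] using hb ⟨0, Nat.pos_of_ne_zero hn⟩
    rw [L.bracket.map_coord_zero _ this, map_zero]
  | succ N ih =>
    rw [pow_succ, Module.End.mul_apply, hD, map_sum]
    refine Finset.sum_eq_zero fun j _ => ?_
    rcases hj : m j with _ | k
    · have hbj : b j = 0 := by simpa [hj] using hb j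
      rw [hbj, map_zero, L.bracket.map_update_zero, map_zero]
    · refine ih _ (Function.update m j k) ?_ fun i => ?_
      · rw [Finset.sum_update_of_mem (Finset.mem_univ j)]
        rw [← Finset.add_sum_erase _ _ (Finset.mem_univ j), Finset.erase_eq] at hm
        omega
      · rcases eq_or_ne i j with rfl | hij
        · simpa [hj, pow_succ] using hb i
        · simpa [hij] using hb i

/-- The Fitting null component of a derivation is a subalgebra. -/
theorem IsDerivation.isSubalgebra_ker_pow_finrank [FiniteDimensional F A] {L : NLie F A n}
    (hn : n ≠ 0) {D : Module.End F A} (hD : L.IsDerivation D) :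
    L.IsSubalgebra (LinearMap.ker (D ^ Module.finrank F A)) := fun x hx =>
  Module.End.ker_pow_le_ker_pow_finrank D (n * Module.finrank F A)
    (hD.pow_bracket_eq_zero hn _ x (fun _ => Module.finrank F A) (by simp) hx)

theorem isNilpotent_of_mem_derivedDerivations [FiniteDimensional F A] (hn : n ≠ 0)
    {L : NLie F A n} (h : ∀ K, L.IsSubalgebra K → K ⊔ L.derived = ⊤ → K = ⊤)
    {D : Module.End F A} (hD : D ∈ L.derivedDerivations) : IsNilpotent D := by
  refine ⟨Module.finrank F A,
    LinearMap.ker_eq_top.1 (h _ (hD.1.isSubalgebra_ker_pow_finrank hn) ?_)⟩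
  obtain ⟨k, hk, hk0⟩ := (D.eventually_isCompl_ker_pow_range_pow.and
    (Filter.eventually_ne_atTop 0)).exists
  rw [eq_top_iff, ← hk.sup_eq_top]
  refine sup_le_sup (Module.End.ker_pow_le_ker_pow_finrank D k) ?_
  rintro _ ⟨x, rfl⟩
  rw [← Nat.succ_pred hk0, Nat.succ_eq_add_one, pow_succ']
  exact hD.2 _

theorem lcs_le_lowerCentralSeries (L : NLie F A n) (s : ℕ) :
    L.lcs s ≤ (LieModule.lowerCentralSeries F L.derivedDerivations A s).toSubmodule := by
  induction s with
  | zero => simp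
  | succ s ih =>
    refine Submodule.span_le.2 ?_
    rintro _ ⟨x, ⟨i, hi⟩, rfl⟩
    rw [← L.mulOperator_lie x i, LieModule.lowerCentralSeries_succ]
    exact LieSubmodule.lie_mem_lie (LieSubmodule.mem_top _) (ih hi)

end NLie

/-- A finite-dimensional `n`-Lie algebra is nilpotent if and only if it satisfies
condition (*): the only subalgebra `K` with `K + A² = A` is `K = A`. -/
theorem nilpotent_iff_star_condition {F A : Type*} [Field F] [AddCommGroup A]
    [Module F A] [FiniteDimensional F A] {n : ℕ} (hn : 2 ≤ n) (L : NLie F A n) :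
    L.IsNilpotentAlg ↔ ∀ K, L.IsSubalgebra K → K ⊔ L.derived = ⊤ → K = ⊤ := by
  constructor
  · rintro ⟨v, hv⟩ K hK h
    simpa [hv] using hK.sup_lcs_eq_top h v
  · intro h
    have hnil : LieModule.IsNilpotent L.derivedDerivations A :=
      (LieModule.isNilpotent_iff_forall' (R := F)).2 fun D =>
        NLie.isNilpotent_of_mem_derivedDerivations (by omega) h D.2
    obtain ⟨k, hk⟩ := (LieModule.isNilpotent_iff F L.derivedDerivations A).1 hnil
    exact ⟨k, le_bot_iff.1 (by simpa [hk] using L.lcs_le_lowerCentralSeries k)⟩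
end
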